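/- Let X ⊆ ℝ^d be compact, let P be a compact (in the weak-* topology) set of Borel probability measures on X, and let Q be a compact (in the weak-* topology) set of Borel probability measures on P. Let σ: ℝ → ℝ be continuous and not an algebraic polynomial. Then the class of four-layer nested multi-instance neural networks, i.e. functions of the form f(q) = W₁ σ(W₂ (∫_P σ(W₃ (∫_X σ(W₄ x + b₄) dp(x)) + b₃) dq(p)) + b₂) + b₁ — with real matrices W₁, W₂, W₃, W₄ and bias vectors b₁, b₂, b₃, b₄ of appropriate (arbitrary finite) dimensions, σ applied coordinate-wise and the integrals taken coordinate-wise — is dense in C(Q, ℝ) with the supremum metric. -/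

import Mathlib

open MeasureTheory
open scoped Topology ContDiff

theorem Submodule.integral_mem_of_isClosed {α E : Type*} [MeasurableSpace α] {μ : Measure α}
    [NormedAddCommGroup E] [NormedSpace ℝ E] [CompleteSpace E] (M : Submodule ℝ E)
    (hM : IsClosed (M : Set E)) {f : α → E} (hf : Integrable f μ) (hfM : ∀ a, f a ∈ M) :
    ∫ a, f a ∂μ ∈ M := by
  by_contra h
  obtain ⟨Λ, u, hu, hx⟩ := geometric_hahn_banach_closed_point M.convex hM h
  have hΛ : ∀ m ∈ M, Λ m = 0 := by
    intro m hm
    by_contra h0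
    have := hu ((u / Λ m) • m) (M.smul_mem _ hm)
    rw [map_smul, smul_eq_mul, div_mul_cancel₀ _ h0] at this
    exact lt_irrefl _ this
  have h0 := hu 0 M.zero_mem
  rw [map_zero] at h0
  rw [← Λ.integral_comp_comm hf] at hx
  simp only [hΛ _ (hfM _), integral_zero] at hx
  exact lt_asymm h0 hx

namespace ContinuousMap

variable {S : Type*} [TopologicalSpace S] [CompactSpace S]

theorem comp_convolution_mem {M : Submodule ℝ C(S, ℝ)} (hM : IsClosed (M : Set C(S, ℝ)))
    {σ ψ : C(ℝ, ℝ)} {φ : ℝ → ℝ} (hφ : Continuous φ) (hφc : HasCompactSupport φ)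
    (hψ : ∀ x, ψ x = ∫ t, φ t * σ (x - t)) {l : C(S, ℝ)}
    (h : ∀ b, σ.comp (l + const S b) ∈ M) : ψ.comp l ∈ M := by
  let F : ℝ → C(S, ℝ) := fun t ↦ φ t • σ.comp (l + const S (-t))
  have hF : Continuous F := by
    refine hφ.smul (continuous_of_continuous_uncurry _ ?_)
    change Continuous fun p : ℝ × S ↦ σ (l p.2 + -p.1)
    fun_prop
  have hFi : Integrable F := hF.integrable_of_hasCompactSupport (hφc.smul_right)
  convert M.integral_mem_of_isClosed hM hFi fun t ↦ M.smul_mem _ (h _)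
  ext x
  rw [integral_apply hFi]
  simp [F, hψ, sub_eq_add_neg]

theorem iteratedDeriv_smul_pow_mem {M : Submodule ℝ C(S, ℝ)} (hM : IsClosed (M : Set C(S, ℝ)))
    {ψ : C(ℝ, ℝ)} (hψ : ContDiff ℝ ∞ ψ) {l : C(S, ℝ)}
    (h : ∀ w b : ℝ, ψ.comp (w • l + const S b) ∈ M) (b : ℝ) (k : ℕ) :
    iteratedDeriv k ψ b • l ^ k ∈ M := by
  induction k using Nat.strong_induction_on with
  | _ k ih =>
  suffices hk : ((k.factorial : ℝ)⁻¹ * iteratedDeriv k ψ b) • l ^ k ∈ M by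
    have := M.smul_mem (k.factorial : ℝ) hk
    rwa [smul_smul, mul_inv_cancel_left₀ (by positivity)] at this
  rw [← SetLike.mem_coe, ← hM.closure_eq, Metric.mem_closure_iff]
  intro ε hε
  have hT := taylor_isLittleO_univ (x₀ := b) (n := k) (hψ.of_le (by exact_mod_cast le_top))
  set K := ‖l‖ + 1
  have hK : 0 < K := by positivity
  have hc : 0 < ε / 2 / K ^ k := by positivity
  obtain ⟨δ, hδ, hδT⟩ := Metric.eventually_nhds_iff.1 (hT.def hc)
  set w := δ / 2 / K
  have hw : 0 < w := by positivity
  refine ⟨(w ^ k)⁻¹ • (ψ.comp (w • l + const S b) -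
    ∑ j ∈ Finset.range k, ((j.factorial : ℝ)⁻¹ * w ^ j) • iteratedDeriv j ψ b • l ^ j), ?_, ?_⟩
  · exact M.smul_mem _ (M.sub_mem (h _ _) (M.sum_mem fun j hj ↦
      M.smul_mem _ (ih j (Finset.mem_range.1 hj))))
  rw [dist_comm, dist_eq_norm]
  refine lt_of_le_of_lt ((norm_le _ (by positivity : 0 ≤ ε / 2)).2 fun x ↦ ?_) (half_lt_self hε)
  have hlx : |l x| ≤ K := (l.norm_coe_le_norm x).trans (by simp [K])
  have hwx : |w * l x| ≤ δ / 2 := by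
    rw [abs_mul, abs_of_pos hw]
    calc w * |l x| ≤ w * K := by gcongr
      _ = δ / 2 := by simp only [w]; field_simp
  have := @hδT (b + w * l x) (by
    rw [Real.dist_eq, add_sub_cancel_left]
    linarith)
  simp only [taylor_within_apply, iteratedDerivWithin_univ, add_sub_cancel_left, norm_pow,
    Real.norm_eq_abs, Finset.sum_range_succ, smul_eq_mul] at this
  have hw' : (w ^ k) ≠ 0 := by positivity
  have e : ((w ^ k)⁻¹ • (ψ.comp (w • l + const S b) -
    ∑ j ∈ Finset.range k, ((j.factorial : ℝ)⁻¹ * w ^ j) • iteratedDeriv j ψ b • l ^ j) -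
      ((k.factorial : ℝ)⁻¹ * iteratedDeriv k ψ b) • l ^ k) x = (w ^ k)⁻¹ * (ψ (b + w * l x) -
      (∑ j ∈ Finset.range k, (j.factorial : ℝ)⁻¹ * (w * l x) ^ j * iteratedDeriv j ψ b +
        (k.factorial : ℝ)⁻¹ * (w * l x) ^ k * iteratedDeriv k ψ b)) := by
    simp only [coe_sub, coe_smul, Pi.sub_apply, Pi.smul_apply, comp_apply, coe_add, Pi.add_apply,
      const_apply, coe_sum, Finset.sum_apply, coe_pow, Pi.pow_apply, smul_eq_mul]
    rw [add_comm (w * l x) b, Finset.sum_congr rfl fun j _ ↦ show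
      (j.factorial : ℝ)⁻¹ * w ^ j * (iteratedDeriv j ψ b * l x ^ j) =
        (j.factorial : ℝ)⁻¹ * (w * l x) ^ j * iteratedDeriv j ψ b by ring]
    field_simp
    ring
  rw [e, norm_mul, norm_inv, norm_pow, Real.norm_eq_abs, Real.norm_eq_abs, abs_of_pos hw,
    inv_mul_le_iff₀ (by positivity)]
  refine this.trans ?_
  rw [abs_mul, abs_of_pos hw, mul_pow]
  calc ε / 2 / K ^ k * (w ^ k * |l x| ^ k) ≤ ε / 2 / K ^ k * (w ^ k * K ^ k) := by gcongr
    _ = w ^ k * (ε / 2) := by field_simp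

end ContinuousMap

theorem exists_polynomial_of_iteratedDeriv_eq_zero {f : ℝ → ℝ} (hf : ContDiff ℝ ∞ f) {n : ℕ}
    (h : ∀ x, iteratedDeriv n f x = 0) :
    ∃ p : Polynomial ℝ, p.degree < n ∧ ∀ x, f x = p.eval x := by
  cases n with
  | zero => exact ⟨0, by simp, by simpa using h⟩
  | succ n =>
  refine ⟨∑ j ∈ Finset.range (n + 1),
    Polynomial.C ((j.factorial : ℝ)⁻¹ * iteratedDeriv j f 0) * Polynomial.X ^ j, ?_, fun x ↦ ?_⟩
  · refine (Polynomial.degree_sum_le _ _).trans_lt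
      ((Finset.sup_lt_iff (WithBot.bot_lt_coe _)).2 fun j hj ↦ ?_)
    exact (Polynomial.degree_C_mul_X_pow_le _ _).trans_lt
      (by exact_mod_cast Finset.mem_range.1 hj)
  have hs :
      ∑ j ∈ Finset.range (n + 1), (j.factorial : ℝ)⁻¹ * iteratedDeriv j f 0 * x ^ j = f x := by
    rcases eq_or_ne 0 x with rfl | hx
    · rw [Finset.sum_range_succ']
      simp
    obtain ⟨y, -, hy⟩ := taylor_mean_remainder_lagrange_iteratedDeriv hx (n := n)
      (f := f) ((hf.of_le (by exact_mod_cast le_top)).contDiffOn)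
    rw [h, zero_mul, zero_div, sub_eq_zero, taylor_within_apply] at hy
    rw [hy]
    refine Finset.sum_congr rfl fun j _ ↦ ?_
    rw [iteratedDerivWithin_eq_iteratedDeriv (uniqueDiffOn_uIcc hx)
      ((hf.of_le (by exact_mod_cast le_top)).contDiffAt) Set.left_mem_uIcc, sub_zero, smul_eq_mul]
    ring
  simp [Polynomial.eval_finsetSum, ← hs]

theorem exists_polynomial_of_tendsto {f : ℝ → ℝ} {n : ℕ} {p : ℕ → Polynomial ℝ}
    (hp : ∀ i, (p i).degree < n)
    (h : ∀ x, Filter.Tendsto (fun i ↦ (p i).eval x) Filter.atTop (𝓝 (f x))) :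
    ∃ q : Polynomial ℝ, ∀ x, f x = q.eval x := by
  have hinj : Set.InjOn (fun i : ℕ ↦ (i : ℝ)) (Finset.range n) := Nat.cast_injective.injOn
  refine ⟨Lagrange.interpolate (Finset.range n) (fun i : ℕ ↦ (i : ℝ)) fun i ↦ f i, fun x ↦
    tendsto_nhds_unique (h x) ?_⟩
  have hpi : ∀ i, (p i).eval x = ∑ j ∈ Finset.range n,
      (p i).eval (j : ℝ) * (Lagrange.basis (Finset.range n) (fun i : ℕ ↦ (i : ℝ)) j).eval x := by
    intro i
    conv_lhs => rw [Lagrange.eq_interpolate (f := p i) hinj (by simpa using hp i)]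
    simp [Lagrange.interpolate_apply, Polynomial.eval_finsetSum]
  simp only [hpi, Lagrange.interpolate_apply, Polynomial.eval_finsetSum, Polynomial.eval_mul,
    Polynomial.eval_C]
  exact tendsto_finsetSum _ fun j _ ↦ (h j).mul_const _

theorem exists_common_linear_combination {ι E : Type*} [AddCommGroup E] [Module ℝ E] (v : ι → E)
    {m : ℕ} (h : Fin m → E) (hh : ∀ a, h a ∈ Submodule.span ℝ (Set.range v)) :
    ∃ (k : ℕ) (i : Fin k → ι) (W : Fin m → Fin k → ℝ), ∀ a, h a = ∑ c, W a c • v (i c) := by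
  classical
  choose w hw using fun a ↦ Finsupp.mem_span_range_iff_exists_finsupp.1 (hh a)
  let s : Finset ι := Finset.univ.biUnion fun a ↦ (w a).support
  refine ⟨s.card, fun c ↦ s.equivFin.symm c, fun a c ↦ w a (s.equivFin.symm c), fun a ↦ ?_⟩
  rw [← hw a, s.equivFin.symm.sum_comp fun i : s ↦ w a i • v i, s.sum_coe_sort fun i ↦ w a i • v i]
  exact (w a).sum_of_support_subset
    (Finset.subset_biUnion_of_mem (fun a ↦ (w a).support) (Finset.mem_univ a)) _ (by simp)

namespace ContinuousMap

variable {S : Type*} [TopologicalSpace S]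

/-- The linear span of the functions `σ ∘ (l + b)` with features `l ∈ L` and biases `b ∈ ℝ`. -/
def shallowSpan (σ : C(ℝ, ℝ)) (L : Submodule ℝ C(S, ℝ)) : Submodule ℝ C(S, ℝ) :=
  Submodule.span ℝ (Set.range fun a : L × ℝ ↦ σ.comp ((a.1 : C(S, ℝ)) + const S a.2))

/-- Finitely many shallow networks can be written over one common hidden layer. -/
theorem exists_common_hidden_layer {σ : C(ℝ, ℝ)} {L : Submodule ℝ C(S, ℝ)} {m : ℕ}
    (h : Fin m → C(S, ℝ)) (hh : ∀ a, h a ∈ shallowSpan σ L) :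
    ∃ (k : ℕ) (l : Fin k → C(S, ℝ)) (b : Fin k → ℝ) (W : Fin m → Fin k → ℝ),
      (∀ c, l c ∈ L) ∧ ∀ a, h a = ∑ c, W a c • σ.comp (const S (b c) + l c) := by
  obtain ⟨k, i, W, hW⟩ := exists_common_linear_combination _ h hh
  refine ⟨k, fun c ↦ (i c).1, fun c ↦ (i c).2, W, fun c ↦ (i c).1.2, fun a ↦ ?_⟩
  simp only [hW, add_comm]

variable [CompactSpace S]

theorem pow_mem_of_comp_affine_mem {M : Submodule ℝ C(S, ℝ)} (hM : IsClosed (M : Set C(S, ℝ)))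
    {σ : C(ℝ, ℝ)} (hσ : ¬ ∃ q : Polynomial ℝ, ∀ t, σ t = q.eval t) {l : C(S, ℝ)}
    (h : ∀ w b : ℝ, σ.comp (w • l + const S b) ∈ M) (k : ℕ) : l ^ k ∈ M := by
  by_contra hk
  apply hσ
  let φ : ℕ → ContDiffBump (0 : ℝ) := fun n ↦
    ⟨1 / (n + 1) / 2, 1 / (n + 1), by positivity, half_lt_self (by positivity)⟩
  let ψ : ℕ → ℝ → ℝ := fun n ↦
    convolution ((φ n).normed volume) σ (ContinuousLinearMap.lsmul ℝ ℝ) volume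
  have hψ : ∀ n, ContDiff ℝ ∞ (ψ n) := fun n ↦
    (φ n).hasCompactSupport_normed.contDiff_convolution_left _ (φ n).contDiff_normed
      σ.continuous.locallyIntegrable
  have hψM : ∀ n (w b : ℝ),
      (⟨ψ n, (hψ n).continuous⟩ : C(ℝ, ℝ)).comp (w • l + const S b) ∈ M := by
    intro n w b
    refine comp_convolution_mem hM (φ n).continuous_normed (φ n).hasCompactSupport_normed
      (fun x ↦ rfl) fun c ↦ ?_
    convert h w (b + c) using 2
    ext x
    simp [add_assoc]
  have hz : ∀ n x, iteratedDeriv k (ψ n) x = 0 := by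
    intro n x
    by_contra h0
    have := iteratedDeriv_smul_pow_mem hM (ψ := ⟨ψ n, (hψ n).continuous⟩) (hψ n) (hψM n) x k
    exact hk ((M.smul_mem_iff h0).1 this)
  choose p hp hpe using fun n ↦ exists_polynomial_of_iteratedDeriv_eq_zero (hψ n) (hz n)
  refine exists_polynomial_of_tendsto hp fun x ↦ ?_
  simp only [← hpe]
  exact ContDiffBump.convolution_tendsto_right_of_continuous
    tendsto_one_div_add_atTop_nhds_zero_nat σ.continuous x

theorem exp_apply (l : C(S, ℝ)) (x : S) : NormedSpace.exp l x = Real.exp (l x) := by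
  rw [Real.exp_eq_exp_ℝ]
  exact NormedSpace.map_exp (evalAlgHom ℝ ℝ x) (continuous_eval_const x) l

/-- Shallow networks with a non-polynomial activation, built on a separating linear space of
features, are dense. -/
theorem shallowSpan_dense (L : Submodule ℝ C(S, ℝ))
    (hL : ∀ x y : S, x ≠ y → ∃ l ∈ L, l x ≠ l y)
    {σ : C(ℝ, ℝ)} (hσ : ¬ ∃ q : Polynomial ℝ, ∀ t, σ t = q.eval t) :
    (shallowSpan σ L).topologicalClosure = ⊤ := by
  set N := shallowSpan σ L
  have hM := N.isClosed_topologicalClosure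
  have hexp : ∀ l ∈ L, NormedSpace.exp l ∈ N.topologicalClosure := by
    intro l hl
    refine hM.mem_of_tendsto (NormedSpace.exp_series_hasSum_exp' (𝕂 := ℝ) l)
      (.of_forall fun s ↦ N.topologicalClosure.sum_mem fun k _ ↦
        N.topologicalClosure.smul_mem _ (pow_mem_of_comp_affine_mem hM hσ (fun w b ↦ ?_) k))
    exact N.le_topologicalClosure (Submodule.subset_span ⟨(⟨w • l, L.smul_mem w hl⟩, b), rfl⟩)
  let E : Submonoid C(S, ℝ) :=
    { carrier := NormedSpace.exp '' (L : Set C(S, ℝ))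
      one_mem' := ⟨0, L.zero_mem, NormedSpace.exp_zero⟩
      mul_mem' := by
        rintro _ _ ⟨l, hl, rfl⟩ ⟨l', hl', rfl⟩
        exact ⟨l + l', L.add_mem hl hl', NormedSpace.exp_add⟩ }
  have hE : (Algebra.adjoin ℝ (E : Set C(S, ℝ))).toSubmodule ≤ N.topologicalClosure := by
    rw [Algebra.adjoin_eq_span, Submonoid.closure_eq, Submodule.span_le]
    rintro _ ⟨l, hl, rfl⟩
    exact hexp l hl
  have hsep : (Algebra.adjoin ℝ (E : Set C(S, ℝ))).SeparatesPoints := by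
    intro x y hxy
    obtain ⟨l, hl, hne⟩ := hL x y hxy
    refine ⟨_, ⟨NormedSpace.exp l, Algebra.subset_adjoin ⟨l, hl, rfl⟩, rfl⟩, ?_⟩
    simpa [exp_apply] using hne
  have htop := subalgebra_topologicalClosure_eq_top_of_separatesPoints _ hsep
  rw [eq_top_iff]
  intro f _
  have hf : f ∈ (Algebra.adjoin ℝ (E : Set C(S, ℝ))).topologicalClosure := htop ▸ Algebra.mem_top
  exact closure_minimal hE hM hf

end ContinuousMap

/-- Integration of continuous functions against the measures in `R`, as a linear map. -/
noncomputable def integralMap {S : Type*} [TopologicalSpace S] [CompactSpace S] [MeasurableSpace S]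
    [OpensMeasurableSpace S] (R : Set (ProbabilityMeasure S)) : C(S, ℝ) →ₗ[ℝ] C(R, ℝ) where
  toFun g := ⟨fun μ ↦ ∫ x, g x ∂((μ : ProbabilityMeasure S) : Measure S),
    (ProbabilityMeasure.continuous_integral_boundedContinuousFunction
      (BoundedContinuousFunction.mkOfCompact g)).comp continuous_subtype_val⟩
  map_add' g h := by
    ext μ
    exact integral_add (g.continuous.integrable_of_hasCompactSupport (.of_compactSpace _))
      (h.continuous.integrable_of_hasCompactSupport (.of_compactSpace _))
  map_smul' c g := by
    ext μ
    exact integral_const_mul c _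

theorem integralMap_apply {S : Type*} [TopologicalSpace S] [CompactSpace S] [MeasurableSpace S]
    [OpensMeasurableSpace S] (R : Set (ProbabilityMeasure S)) (g : C(S, ℝ)) (μ : R) :
    integralMap R g μ = ∫ x, g x ∂((μ : ProbabilityMeasure S) : Measure S) := rfl

theorem exists_integralMap_ne {S : Type*} [TopologicalSpace S] [CompactSpace S]
    [MeasurableSpace S] [BorelSpace S] [HasOuterApproxClosed S] (R : Set (ProbabilityMeasure S))
    {N : Submodule ℝ C(S, ℝ)} (hN : N.topologicalClosure = ⊤) (μ ν : R) (h : μ ≠ ν) :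
    ∃ l ∈ N.map (integralMap R), l μ ≠ l ν := by
  by_contra! hl
  apply h
  have heq : ∀ g : C(S, ℝ), integralMap R g μ = integralMap R g ν := by
    intro g
    have hg : g ∈ N.topologicalClosure := hN ▸ Submodule.mem_top
    have hcont : ∀ ρ : R, Continuous fun g ↦ integralMap R g ρ := fun ρ ↦
      AddMonoidHomClass.continuous_of_bound
        ((ContinuousMap.evalAlgHom ℝ ℝ ρ).toLinearMap ∘ₗ integralMap R) 1 fun g ↦ by
          simpa [integralMap_apply] using
            (norm_integral_le_of_norm_le_const (.of_forall g.norm_coe_le_norm) :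
              ‖∫ x, g x ∂((ρ : ProbabilityMeasure S) : Measure S)‖ ≤ _)
    exact closure_minimal (fun g hg ↦ hl _ ⟨g, hg, rfl⟩) (isClosed_eq (hcont μ) (hcont ν)) hg
  exact Subtype.ext (ProbabilityMeasure.toMeasure_injective
    (ext_of_forall_integral_eq_of_IsFiniteMeasure fun g ↦ heq g.toContinuousMap))

/-- The restrictions to `X` of the linear forms on `ℝ^d`, as a linear function of the weights. -/
noncomputable def linearFormMap {d : ℕ} (X : Set (Fin d → ℝ)) : (Fin d → ℝ) →ₗ[ℝ] C(X, ℝ) where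
  toFun w := ⟨fun x ↦ ∑ j, w j * (x : Fin d → ℝ) j, continuous_finsetSum _ fun j _ ↦
    continuous_const.mul ((continuous_apply j).comp continuous_subtype_val)⟩
  map_add' v w := by
    ext x
    simp [add_mul, Finset.sum_add_distrib]
  map_smul' c w := by
    ext x
    simp [Finset.mul_sum, mul_assoc]

theorem exists_linearFormMap_ne {d : ℕ} (X : Set (Fin d → ℝ)) (x y : X) (h : x ≠ y) :
    ∃ l ∈ LinearMap.range (linearFormMap X), l x ≠ l y := by
  obtain ⟨j, hj⟩ := Function.ne_iff.1 (Subtype.coe_ne_coe.2 h)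
  exact ⟨_, ⟨Pi.single j 1, rfl⟩, by simpa [linearFormMap, Pi.single_apply] using hj⟩

/-- Density of four-layer nested multi-instance neural networks in C(Q, ℝ),
where Q is a compact (weak-*) set of Borel probability measures on a compact
(weak-*) set P of Borel probability measures on a compact X ⊆ ℝ^d, and σ is
continuous and non-polynomial. The network is
q ↦ W₁ σ(W₂ (∫_P σ(W₃ (∫_X σ(W₄ x + b₄) dp) + b₃) dq(p)) + b₂) + b₁,
with σ and integrals taken coordinate-wise. -/
theorem stmt_12 {d : ℕ} (X : Set (Fin d → ℝ)) (hX : IsCompact X)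
    (P : Set (ProbabilityMeasure ↥X)) (hP : IsCompact P)
    [MeasurableSpace ↥P] [BorelSpace ↥P]
    (Q : Set (ProbabilityMeasure ↥P)) (hQ : IsCompact Q)
    (σ : ℝ → ℝ) (hσ_cont : Continuous σ)
    (hσ_nonpoly : ¬ ∃ q : Polynomial ℝ, ∀ t : ℝ, σ t = q.eval t)
    (f : ↥Q → ℝ) (hf : Continuous f) :
    ∀ ε > 0, ∃ (r k m : ℕ)
      (W₄ : Fin r → Fin d → ℝ) (b₄ : Fin r → ℝ)
      (W₃ : Fin k → Fin r → ℝ) (b₃ : Fin k → ℝ)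
      (W₂ : Fin m → Fin k → ℝ) (b₂ : Fin m → ℝ)
      (W₁ : Fin m → ℝ) (b₁ : ℝ),
      ∀ q : ↥Q,
        |f q - (b₁ + ∑ a, W₁ a * σ (b₂ a + ∑ c, W₂ a c *
          ∫ p : ↥P, σ (b₃ c + ∑ e, W₃ c e *
            ∫ x : ↥X, σ (b₄ e + ∑ j, W₄ e j * (x : Fin d → ℝ) j)
              ∂((p : ProbabilityMeasure ↥X) : Measure ↥X))
            ∂((q : ProbabilityMeasure ↥P) : Measure ↥P)))| < ε := by
  intro ε hε
  have : CompactSpace X := isCompact_iff_compactSpace.1 hX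
  have : CompactSpace P := isCompact_iff_compactSpace.1 hP
  have : CompactSpace Q := isCompact_iff_compactSpace.1 hQ
  have hd₁ := ContinuousMap.shallowSpan_dense _ (exists_linearFormMap_ne X)
    (σ := ⟨σ, hσ_cont⟩) hσ_nonpoly
  have hd₂ := ContinuousMap.shallowSpan_dense _ (exists_integralMap_ne P hd₁)
    (σ := ⟨σ, hσ_cont⟩) hσ_nonpoly
  have hd₃ := ContinuousMap.shallowSpan_dense _ (exists_integralMap_ne Q hd₂)
    (σ := ⟨σ, hσ_cont⟩) hσ_nonpoly
  have hfc : (⟨f, hf⟩ : C(Q, ℝ)) ∈ Submodule.topologicalClosure _ := hd₃ ▸ Submodule.mem_top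
  obtain ⟨F, hF, hfF⟩ := Metric.mem_closure_iff.1 hfc ε hε
  obtain ⟨m, l₁, b₂, W₁, hl₁, hW₁⟩ :=
    ContinuousMap.exists_common_hidden_layer (fun _ : Fin 1 ↦ F) fun _ ↦ hF
  choose h hh hhl using hl₁
  obtain ⟨k, l₂, b₃, W₂, hl₂, hW₂⟩ := ContinuousMap.exists_common_hidden_layer h hh
  choose g hg hgl using hl₂
  obtain ⟨r, l₃, b₄, W₃, hl₃, hW₃⟩ := ContinuousMap.exists_common_hidden_layer g hg
  choose W₄ hW₄ using hl₃
  refine ⟨r, k, m, W₄, b₄, W₃, b₃, W₂, b₂, W₁ 0, 0, fun q ↦ ?_⟩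
  have hq := (ContinuousMap.dist_apply_le_dist q).trans_lt hfF
  rw [Real.dist_eq] at hq
  simp only [hW₁ 0, ← hhl, hW₂, ← hgl, hW₃, ← hW₄, map_sum, map_smul, ContinuousMap.sum_apply,
    ContinuousMap.smul_apply, smul_eq_mul, ContinuousMap.comp_apply, ContinuousMap.add_apply,
    ContinuousMap.const_apply, integralMap_apply, ContinuousMap.coe_mk, linearFormMap,
    LinearMap.coe_mk, AddHom.coe_mk] at hq
  simpa only [zero_add] using hq
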